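/- (X,T) is a weakly mixing E-system if and only if the induced system (M(X), T_M) on the space of probability measures is an E-system. -/

import Mathlib

open MeasureTheory Topology Set Function TopologicalSpace

noncomputable section

namespace Paper

/-- The orbit closure of a point. -/
def orbitClosure {α : Type*} [TopologicalSpace α] (T : α → α) (x : α) : Set α :=
  closure (Set.range fun n : ℕ => T^[n] x)

/-- Topological transitivity: `N(U,V)` is infinite for all non-empty open `U, V`. -/
def IsTransitive {α : Type*} [TopologicalSpace α] (T : α → α) : Prop :=
  ∀ U V : Set α, IsOpen U → U.Nonempty → IsOpen V → V.Nonempty →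
    {n : ℕ | (U ∩ T^[n] ⁻¹' V).Nonempty}.Infinite

/-- Weak mixing: the product system is transitive. -/
def IsWeaklyMixing {α : Type*} [TopologicalSpace α] (T : α → α) : Prop :=
  IsTransitive (Prod.map T T)

/-- Total transitivity. -/
def IsTotallyTransitive {α : Type*} [TopologicalSpace α] (T : α → α) : Prop :=
  ∀ n : ℕ, 0 < n → IsTransitive (T^[n])

/-- A minimal point: its orbit closure is a minimal subsystem. -/
def IsMinimalPoint {α : Type*} [TopologicalSpace α] (T : α → α) (x : α) : Prop :=
  ∀ Y : Set α, Y.Nonempty → IsClosed Y → MapsTo T Y Y → Y ⊆ orbitClosure T x →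
    Y = orbitClosure T x

def IsPeriodicPoint {α : Type*} (T : α → α) (x : α) : Prop :=
  ∃ n : ℕ, 0 < n ∧ T^[n] x = x

def IsPeriodicSystem {α : Type*} (T : α → α) : Prop :=
  ∃ m : ℕ, 0 < m ∧ T^[m] = id

def IsPointwisePeriodic {α : Type*} (T : α → α) : Prop :=
  ∀ x : α, IsPeriodicPoint T x

def IsMSystem {α : Type*} [TopologicalSpace α] (T : α → α) : Prop :=
  IsTransitive T ∧ Dense {x : α | IsMinimalPoint T x}

def IsPSystem {α : Type*} [TopologicalSpace α] (T : α → α) : Prop :=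
  IsTransitive T ∧ Dense {x : α | IsPeriodicPoint T x}

/-- An E-system: transitive with an invariant (Borel) probability measure of full support. -/
def IsESystem {α : Type*} [TopologicalSpace α] (T : α → α) : Prop :=
  IsTransitive T ∧
    let _i : MeasurableSpace α := borel α
    ∃ μ : Measure α, IsProbabilityMeasure μ ∧ μ.map T = μ ∧
      ∀ U : Set α, IsOpen U → U.Nonempty → 0 < μ U

/-- A proximal pair: the orbit closure of `(x, y)` meets the diagonal. -/
def IsProximalPair {α : Type*} [TopologicalSpace α] (T : α → α) (x y : α) : Prop :=
  ∃ z : α, (z, z) ∈ closure (Set.range fun n : ℕ => (T^[n] x, T^[n] y))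

def IsDistalPoint {α : Type*} [TopologicalSpace α] (T : α → α) (x : α) : Prop :=
  ∀ y ∈ orbitClosure T x, IsProximalPair T x y → y = x

def IsDistalSystem {α : Type*} [TopologicalSpace α] (T : α → α) : Prop :=
  ∀ x y : α, IsProximalPair T x y → x = y

/-- The induced map on the hyperspace of non-empty compact (= closed) subsets. -/
def TK {α : Type*} [TopologicalSpace α] (T : α → α) (hT : Continuous T)
    (C : NonemptyCompacts α) : NonemptyCompacts α :=
  ⟨⟨T '' (C : Set α), C.isCompact.image hT⟩, C.nonempty.image T⟩

/-- The induced map on the space of Borel probability measures. -/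
def TM {α : Type*} [TopologicalSpace α] [MeasurableSpace α] [BorelSpace α] (T : α → α)
    (hT : Continuous T) (μ : ProbabilityMeasure α) : ProbabilityMeasure α :=
  μ.map hT.measurable.aemeasurable

/-- Almost dense periodic sets. -/
def AlmostDensePeriodicSets {α : Type*} [TopologicalSpace α] (T : α → α) : Prop :=
  let _i : MeasurableSpace α := borel α
  ∀ U : Set α, IsOpen U → U.Nonempty → ∀ ε : ℝ, 0 < ε →
    ∃ k : ℕ, 0 < k ∧ ∃ μ : Measure α, IsProbabilityMeasure μ ∧ μ.map (T^[k]) = μ ∧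
      μ Uᶜ < ENNReal.ofReal ε

def IsAlmostHYSystem {α : Type*} [TopologicalSpace α] (T : α → α) : Prop :=
  IsTotallyTransitive T ∧ AlmostDensePeriodicSets T

def IsFactorMap {α β : Type*} [TopologicalSpace α] [TopologicalSpace β]
    (T : α → α) (S : β → β) (π : α → β) : Prop :=
  Continuous π ∧ Surjective π ∧ π ∘ T = S ∘ π

def IsJoining {α β : Type*} [TopologicalSpace α] [TopologicalSpace β]
    (T : α → α) (S : β → β) (J : Set (α × β)) : Prop :=
  J.Nonempty ∧ IsClosed J ∧ MapsTo (Prod.map T S) J J ∧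
    Prod.fst '' J = Set.univ ∧ Prod.snd '' J = Set.univ

def AreDisjoint {α β : Type*} [TopologicalSpace α] [TopologicalSpace β]
    (T : α → α) (S : β → β) : Prop :=
  ∀ J : Set (α × β), IsJoining T S J → J = Set.univ

def IsMinimalSystem {β : Type*} [TopologicalSpace β] (S : β → β) : Prop :=
  ∀ Y : Set β, Y.Nonempty → IsClosed Y → MapsTo S Y Y → Y = Set.univ

/-- Disjoint from every minimal system (on a compact metric space). -/
def DisjointFromAllMinimal {α : Type*} [TopologicalSpace α] (T : α → α) : Prop :=
  ∀ (β : Type) (_ : MetricSpace β) (_ : CompactSpace β) (S : β → β),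
    Continuous S → Surjective S → IsMinimalSystem S → AreDisjoint T S

open Filter ProbabilityTheory
open scoped ENNReal BoundedContinuousFunction

section TopologicalDynamics

variable {α : Type*} [TopologicalSpace α] {T : α → α}

theorem isESystem_iff {β : Type*} [TopologicalSpace β] [m : MeasurableSpace β] [BorelSpace β]
    (S : β → β) :
    IsESystem S ↔ IsTransitive S ∧ ∃ μ : Measure β, IsProbabilityMeasure μ ∧ μ.map S = μ ∧
      ∀ U : Set β, IsOpen U → U.Nonempty → 0 < μ U := by
  have h : m = borel β := BorelSpace.measurable_eq
  subst h
  rfl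

theorem IsWeaklyMixing.infinite_inter (h : IsWeaklyMixing T) {U₁ V₁ U₂ V₂ : Set α}
    (hU₁ : IsOpen U₁) (hU₁' : U₁.Nonempty) (hV₁ : IsOpen V₁) (hV₁' : V₁.Nonempty)
    (hU₂ : IsOpen U₂) (hU₂' : U₂.Nonempty) (hV₂ : IsOpen V₂) (hV₂' : V₂.Nonempty) :
    {n : ℕ | (U₁ ∩ T^[n] ⁻¹' V₁).Nonempty ∧ (U₂ ∩ T^[n] ⁻¹' V₂).Nonempty}.Infinite := by
  refine (h (U₁ ×ˢ U₂) (V₁ ×ˢ V₂) (hU₁.prod hU₂) (hU₁'.prod hU₂') (hV₁.prod hV₂)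
    (hV₁'.prod hV₂')).mono ?_
  rintro n ⟨⟨x, y⟩, hxy, hn⟩
  simp only [Prod.map_iterate, mem_preimage, Prod.map_apply, mem_prod] at hxy hn
  exact ⟨⟨x, hxy.1, hn.1⟩, ⟨y, hxy.2, hn.2⟩⟩

theorem IsWeaklyMixing.isTransitive (h : IsWeaklyMixing T) : IsTransitive T :=
  fun _ _ hU hU' hV hV' =>
    (h.infinite_inter hU hU' hV hV' hU hU' hV hV').mono fun _ hn => hn.1

/-- Weak mixing from common hitting times of pairs of open sets with a common source. -/
theorem isWeaklyMixing_of_infinite_inter (hT : Continuous T) (hTs : Surjective T)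
    (h : ∀ U V₁ V₂ : Set α, IsOpen U → U.Nonempty → IsOpen V₁ → V₁.Nonempty → IsOpen V₂ →
      V₂.Nonempty → {n : ℕ | (U ∩ T^[n] ⁻¹' V₁).Nonempty ∧ (U ∩ T^[n] ⁻¹' V₂).Nonempty}.Infinite) :
    IsWeaklyMixing T := by
  rintro U V hU ⟨⟨a, b⟩, hab⟩ hV ⟨⟨c, d⟩, hcd⟩
  obtain ⟨U₁, U₂, hU₁, hU₂, ha, hb, hsU⟩ := isOpen_prod_iff.1 hU a b hab
  obtain ⟨V₁, V₂, hV₁, hV₂, hc, hd, hsV⟩ := isOpen_prod_iff.1 hV c d hcd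
  obtain ⟨m, hm, -⟩ := (h U₁ U₂ U₂ hU₁ ⟨a, ha⟩ hU₂ ⟨b, hb⟩ hU₂ ⟨b, hb⟩).nonempty
  refine (h (U₁ ∩ T^[m] ⁻¹' U₂) V₁ (T^[m] ⁻¹' V₂)
    (hU₁.inter (hU₂.preimage (hT.iterate m))) hm hV₁ ⟨c, hc⟩ (hV₂.preimage (hT.iterate m))
    (Set.Nonempty.preimage ⟨d, hd⟩ (hTs.iterate m))).mono ?_
  rintro n ⟨⟨x, hx, hxn⟩, ⟨y, hy, hyn⟩⟩
  refine ⟨(x, T^[m] y), hsU ⟨hx.1, hy.2⟩, ?_⟩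
  rw [Prod.map_iterate]
  refine hsV ⟨hxn, ?_⟩
  have hcomm : T^[n] (T^[m] y) = T^[m] (T^[n] y) := by
    rw [← iterate_add_apply, add_comm, iterate_add_apply]
  simpa [hcomm] using hyn

/-- Furstenberg's intersection lemma: for a weakly mixing map, hitting time sets of open sets form
a filter base. -/
theorem IsWeaklyMixing.exists_inter_finset (h : IsWeaklyMixing T) [Nonempty α] (hT : Continuous T)
    {ι : Type*} (U V : ι → Set α) (hU : ∀ i, IsOpen (U i)) (hU' : ∀ i, (U i).Nonempty)
    (hV : ∀ i, IsOpen (V i)) (hV' : ∀ i, (V i).Nonempty) (s : Finset ι) :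
    ∃ A B : Set α, IsOpen A ∧ A.Nonempty ∧ IsOpen B ∧ B.Nonempty ∧
      ∀ n, (A ∩ T^[n] ⁻¹' B).Nonempty → ∀ i ∈ s, (U i ∩ T^[n] ⁻¹' V i).Nonempty := by
  classical
  induction s using Finset.induction_on with
  | empty => exact ⟨univ, univ, isOpen_univ, univ_nonempty, isOpen_univ, univ_nonempty, by simp⟩
  | insert i s _ ih =>
    obtain ⟨A, B, hA, hA', hB, hB', hAB⟩ := ih
    obtain ⟨m, hm₁, hm₂⟩ := (h.infinite_inter (hU i) (hU' i) hA hA' (hV i) (hV' i) hB hB').nonempty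
    refine ⟨_, _, (hU i).inter (hA.preimage (hT.iterate m)), hm₁,
      (hV i).inter (hB.preimage (hT.iterate m)), hm₂, ?_⟩
    rintro n ⟨x, ⟨hxU, hxA⟩, hxV, hxB⟩ j hj
    rcases Finset.mem_insert.1 hj with rfl | hj
    · exact ⟨x, hxU, hxV⟩
    · refine hAB n ⟨T^[m] x, hxA, ?_⟩ j hj
      have hcomm : T^[n] (T^[m] x) = T^[m] (T^[n] x) := by
        rw [← iterate_add_apply, add_comm, iterate_add_apply]
      simpa [hcomm] using hxB

/-- A finite power of a weakly mixing map is transitive. -/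
theorem IsWeaklyMixing.isTransitive_pi (h : IsWeaklyMixing T) [Nonempty α]
    (hT : Continuous T) {ι : Type*} [Finite ι] {U V : Set (ι → α)} (hU : IsOpen U)
    (hU' : U.Nonempty) (hV : IsOpen V) (hV' : V.Nonempty) :
    {n : ℕ | ∃ x ∈ U, T^[n] ∘ x ∈ V}.Infinite := by
  have := Fintype.ofFinite ι
  obtain ⟨a, ha⟩ := hU'
  obtain ⟨b, hb⟩ := hV'
  obtain ⟨u, hu, hus⟩ := isOpen_pi_iff'.1 hU a ha
  obtain ⟨v, hv, hvs⟩ := isOpen_pi_iff'.1 hV b hb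
  obtain ⟨A, B, hA, hA', hB, hB', hAB⟩ := h.exists_inter_finset hT u v (fun i => (hu i).1)
    (fun i => ⟨_, (hu i).2⟩) (fun i => (hv i).1) (fun i => ⟨_, (hv i).2⟩) Finset.univ
  refine (h.isTransitive A B hA hA' hB hB').mono fun n hn => ?_
  choose x hx using fun i => hAB n hn i (Finset.mem_univ i)
  exact ⟨x, hus fun i _ => (hx i).1, hvs fun i _ => (hx i).2⟩

end TopologicalDynamics

section UniformAverage

variable {X : Type*} [MeasurableSpace X]

/-- The uniform probability measure on a finite family of points. -/
def uniformAverage {ι : Type*} [Fintype ι] [Nonempty ι] (x : ι → X) : ProbabilityMeasure X :=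
  ⟨(Fintype.card ι : ℝ≥0∞)⁻¹ • ∑ i, Measure.dirac (x i), ⟨by
    simp [ENNReal.inv_mul_cancel]⟩⟩

variable {ι : Type*} [Fintype ι] [Nonempty ι]

theorem toMeasure_uniformAverage (x : ι → X) :
    (uniformAverage x : Measure X) = (Fintype.card ι : ℝ≥0∞)⁻¹ • ∑ i, Measure.dirac (x i) := rfl

theorem uniformAverage_comp_fst {κ : Type*} [Fintype κ] [Nonempty κ] (x : ι → X) :
    uniformAverage (fun p : ι × κ => x p.1) = uniformAverage x := by
  apply Subtype.ext
  refine Measure.ext fun s hs => ?_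
  change (uniformAverage _ : ProbabilityMeasure X).toMeasure s = (uniformAverage x).toMeasure s
  simp only [toMeasure_uniformAverage, Measure.smul_apply, Measure.finsetSum_apply,
    Fintype.sum_prod_type, Finset.sum_const, Finset.card_univ, Fintype.card_prod, smul_eq_mul,
    nsmul_eq_mul, Nat.cast_mul]
  rw [← Finset.mul_sum, ENNReal.mul_inv (by simp) (by simp), mul_assoc,
    ENNReal.inv_mul_cancel_left (by simp) (by simp)]

theorem uniformAverage_comp_snd {κ : Type*} [Fintype κ] [Nonempty κ] (x : ι → X) :
    uniformAverage (fun p : κ × ι => x p.2) = uniformAverage x := by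
  apply Subtype.ext
  refine Measure.ext fun s hs => ?_
  change (uniformAverage _ : ProbabilityMeasure X).toMeasure s = (uniformAverage x).toMeasure s
  simp only [toMeasure_uniformAverage, Measure.smul_apply, Measure.finsetSum_apply,
    Fintype.sum_prod_type, Finset.sum_const, Finset.card_univ, Fintype.card_prod, smul_eq_mul,
    nsmul_eq_mul, Nat.cast_mul]
  rw [ENNReal.mul_inv (by simp) (by simp), mul_comm (_ : ℝ≥0∞)⁻¹, mul_assoc,
    ENNReal.inv_mul_cancel_left (by simp) (by simp)]

end UniformAverage

section Measures

variable {X : Type*} [MetricSpace X] [MeasurableSpace X] [BorelSpace X]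

theorem isOpen_setOf_lt_measure {G : Set X} (hG : IsOpen G) (c : ℝ≥0∞) :
    IsOpen {θ : ProbabilityMeasure X | c < (θ : Measure X) G} := by
  rw [isOpen_iff_mem_nhds]
  intro θ hθ
  exact eventually_lt_of_lt_liminf
    (lt_of_lt_of_le hθ (ProbabilityMeasure.le_liminf_measure_open_of_tendsto tendsto_id hG))

theorem measurable_toMeasure {m : MeasurableSpace (ProbabilityMeasure X)}
    [BorelSpace (ProbabilityMeasure X)] :
    Measurable fun θ : ProbabilityMeasure X => (θ : Measure X) := by
  refine Measurable.measure_of_isPiSystem_of_isProbabilityMeasure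
    (S := {s | IsOpen s}) BorelSpace.measurable_eq isPiSystem_isOpen fun s hs => ?_
  exact measurable_of_Ioi fun c => (isOpen_setOf_lt_measure hs c).measurableSet

theorem continuous_TM {T : X → X} (hT : Continuous T) : Continuous (TM T hT) :=
  ProbabilityMeasure.continuous_map hT

theorem toMeasure_TM {T : X → X} (hT : Continuous T) (θ : ProbabilityMeasure X) :
    (TM T hT θ : Measure X) = (θ : Measure X).map T := rfl

theorem toMeasure_iterate_TM {T : X → X} (hT : Continuous T) (n : ℕ) (θ : ProbabilityMeasure X) :
    ((TM T hT)^[n] θ : Measure X) = (θ : Measure X).map T^[n] := by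
  induction n with
  | zero => simp
  | succ n ih =>
    rw [iterate_succ_apply', toMeasure_TM, ih,
      Measure.map_map hT.measurable (hT.iterate n).measurable, iterate_succ']

variable {ι : Type*} [Fintype ι] [Nonempty ι]

theorem integral_uniformAverage (x : ι → X) (f : X →ᵇ ℝ) :
    ∫ y, f y ∂(uniformAverage x : Measure X) = (Fintype.card ι : ℝ)⁻¹ * ∑ i, f (x i) := by
  rw [toMeasure_uniformAverage, integral_smul_measure,
    integral_finsetSum_measure fun i _ => f.integrable _]
  simp

theorem continuous_uniformAverage : Continuous (uniformAverage : (ι → X) → ProbabilityMeasure X) := by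
  rw [continuous_iff_continuousAt]
  intro x
  rw [ContinuousAt, ProbabilityMeasure.tendsto_iff_forall_integral_tendsto]
  intro f
  simp only [integral_uniformAverage]
  have hc : Continuous fun x : ι → X => (Fintype.card ι : ℝ)⁻¹ * ∑ i, f (x i) := by fun_prop
  exact hc.tendsto x

theorem TM_uniformAverage {T : X → X} (hT : Continuous T) (x : ι → X) :
    TM T hT (uniformAverage x) = uniformAverage (T ∘ x) := by
  apply Subtype.ext
  change (uniformAverage x : Measure X).map T = (uniformAverage (T ∘ x) : Measure X)
  rw [toMeasure_uniformAverage, toMeasure_uniformAverage, Measure.map_smul,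
    Measure.map_finset_sum' hT.aemeasurable]
  simp [Measure.map_dirac' hT.measurable]

theorem iterate_TM_uniformAverage {T : X → X} (hT : Continuous T) (n : ℕ) (x : ι → X) :
    (TM T hT)^[n] (uniformAverage x) = uniformAverage (T^[n] ∘ x) := by
  induction n with
  | zero => simp
  | succ n ih => rw [iterate_succ_apply', ih, TM_uniformAverage, iterate_succ', comp_assoc]

/-- The law of large numbers for a bounded continuous function along an i.i.d. sequence of points. -/
theorem ae_tendsto_average (μ : Measure X) [IsProbabilityMeasure μ] (f : X →ᵇ ℝ) :
    ∀ᵐ ω ∂(Measure.infinitePi fun _ : ℕ => μ), Tendsto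
      (fun n : ℕ => (∑ i ∈ Finset.range n, f (ω i)) / n) atTop (𝓝 (∫ y, f y ∂μ)) := by
  have hmp (i : ℕ) : MeasurePreserving (fun ω : ℕ → X => ω i) (Measure.infinitePi fun _ => μ) μ :=
    ⟨measurable_pi_apply i, Measure.infinitePi_map_eval (fun _ => μ) i⟩
  have hf : Measurable f := f.continuous.measurable
  have hid (i : ℕ) : IdentDistrib (fun ω : ℕ → X => f (ω i)) f (Measure.infinitePi fun _ => μ) μ :=
    ⟨(hf.comp (measurable_pi_apply i)).aemeasurable, hf.aemeasurable, by
      conv_rhs => rw [← (hmp i).map_eq, Measure.map_map hf (measurable_pi_apply i)]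
      rfl⟩
  have hint : Integrable (fun ω : ℕ → X => f (ω 0)) (Measure.infinitePi fun _ => μ) :=
    (hmp 0).integrable_comp_of_integrable (f.integrable μ)
  have hindep : iIndepFun (fun (i : ℕ) (ω : ℕ → X) => f (ω i)) (Measure.infinitePi fun _ => μ) :=
    iIndepFun_infinitePi (P := fun _ : ℕ => μ) (X := fun _ => f) fun _ => hf
  have hlln := strong_law_ae_real _ hint (fun i j hij => hindep.indepFun hij)
    fun i => (hid i).trans (hid 0).symm
  rwa [(hid 0).integral_eq] at hlln

/-- By the law of large numbers, finitely many integrals are approximated simultaneously by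
averages over a finite family of points. -/
theorem exists_uniformAverage_integral_near (μ : ProbabilityMeasure X) (F : Finset (X →ᵇ ℝ))
    {ε : ℝ} (hε : 0 < ε) :
    ∃ (n : ℕ) (x : Fin (n + 1) → X), ∀ f ∈ F,
      dist (∫ y, f y ∂(uniformAverage x : Measure X)) (∫ y, f y ∂(μ : Measure X)) < ε := by
  obtain ⟨ω, hω⟩ := ((Finset.eventually_all F).2 fun f _ => ae_tendsto_average (μ : Measure X) f).exists
  have hev : ∀ᶠ n : ℕ in atTop, ∀ f ∈ F, dist ((∑ i ∈ Finset.range (n + 1), f (ω i)) / (n + 1 : ℕ))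
      (∫ y, f y ∂(μ : Measure X)) < ε :=
    (Finset.eventually_all F).2 fun f hf =>
      ((hω f hf).comp (tendsto_add_atTop_nat 1)).eventually (Metric.ball_mem_nhds _ hε)
  obtain ⟨n, hn⟩ := hev.exists
  refine ⟨n, fun i => ω i, fun f hf => ?_⟩
  have := hn f hf
  rwa [integral_uniformAverage, Fintype.card_fin, Fin.sum_univ_eq_sum_range (fun i => f (ω i)),
    inv_mul_eq_div]

theorem dense_uniformAverage :
    Dense {θ : ProbabilityMeasure X | ∃ (n : ℕ) (x : Fin (n + 1) → X), uniformAverage x = θ} := by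
  classical
  intro μ
  choose n x hx using fun p : Finset (X →ᵇ ℝ) × ℕ =>
    exists_uniformAverage_integral_near μ p.1 (Nat.one_div_pos_of_nat (α := ℝ) (n := p.2))
  refine mem_closure_of_tendsto (f := fun p => uniformAverage (x p)) (b := atTop) ?_
    (Eventually.of_forall fun p => ⟨_, _, rfl⟩)
  rw [ProbabilityMeasure.tendsto_iff_forall_integral_tendsto]
  intro f
  rw [tendsto_iff_dist_tendsto_zero]
  refine squeeze_zero' (g := fun p : Finset (X →ᵇ ℝ) × ℕ => 1 / ((p.2 : ℝ) + 1))
    (Eventually.of_forall fun _ => dist_nonneg) ?_ ?_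
  · filter_upwards [eventually_ge_atTop (({f}, 0) : Finset (X →ᵇ ℝ) × ℕ)] with p hp
    exact (hx p f (hp.1 (Finset.mem_singleton_self f))).le
  · rw [← prod_atTop_atTop_eq]
    exact (tendsto_one_div_add_atTop_nhds_zero_nat (𝕜 := ℝ)).comp tendsto_snd

theorem exists_uniformAverage_mem {W : Set (ProbabilityMeasure X)} (hW : IsOpen W)
    (hW' : W.Nonempty) : ∃ (n : ℕ) (x : Fin (n + 1) → X), uniformAverage x ∈ W := by
  obtain ⟨_, ⟨n, x, rfl⟩, hx⟩ := dense_uniformAverage.exists_mem_open hW hW'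
  exact ⟨n, x, hx⟩

/-- A weakly mixing map induces a transitive map on probability measures. -/
theorem IsWeaklyMixing.isTransitive_TM {T : X → X} (h : IsWeaklyMixing T)
    (hT : Continuous T) : IsTransitive (TM T hT) := by
  intro U V hU hU' hV hV'
  obtain ⟨n, x, hx⟩ := exists_uniformAverage_mem hU hU'
  obtain ⟨m, y, hy⟩ := exists_uniformAverage_mem hV hV'
  have : Nonempty X := ⟨x 0⟩
  rw [← uniformAverage_comp_fst (κ := Fin (m + 1))] at hx
  rw [← uniformAverage_comp_snd (κ := Fin (n + 1))] at hy
  refine (h.isTransitive_pi hT (hU.preimage continuous_uniformAverage) ⟨_, hx⟩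
    (hV.preimage continuous_uniformAverage) ⟨_, hy⟩).mono ?_
  rintro k ⟨z, hzU, hzV⟩
  refine ⟨_, hzU, ?_⟩
  rwa [mem_preimage, iterate_TM_uniformAverage]

/-- A fully supported invariant measure induces one on the space of probability measures. -/
theorem exists_invariant_measure_TM [SecondCountableTopology X]
    {m : MeasurableSpace (ProbabilityMeasure X)} [BorelSpace (ProbabilityMeasure X)] {T : X → X}
    (hT : Continuous T) (μ : Measure X) [IsProbabilityMeasure μ] (hμ : μ.map T = μ)
    (hpos : ∀ U : Set X, IsOpen U → U.Nonempty → 0 < μ U) :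
    ∃ ν : Measure (ProbabilityMeasure X), IsProbabilityMeasure ν ∧ ν.map (TM T hT) = ν ∧
      ∀ U : Set (ProbabilityMeasure X), IsOpen U → U.Nonempty → 0 < ν U := by
  let κ (n : ℕ) : Measure (ProbabilityMeasure X) :=
    (Measure.pi fun _ : Fin (n + 1) => μ).map uniformAverage
  have hD (n : ℕ) : Measurable (uniformAverage : (Fin (n + 1) → X) → ProbabilityMeasure X) :=
    continuous_uniformAverage.measurable
  have hκ (n : ℕ) : κ n univ = 1 := by
    rw [Measure.map_apply (hD n) MeasurableSet.univ, preimage_univ, measure_univ]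
  have hκT (n : ℕ) : (κ n).map (TM T hT) = κ n := by
    have hcomp : TM T hT ∘ (uniformAverage : (Fin (n + 1) → X) → _)
        = uniformAverage ∘ fun x i => T (x i) := funext fun x => TM_uniformAverage hT x
    have hmeas : Measurable fun (x : Fin (n + 1) → X) i => T (x i) :=
      measurable_pi_lambda _ fun i => hT.measurable.comp (measurable_pi_apply i)
    rw [Measure.map_map (continuous_TM hT).measurable (hD n), hcomp,
      ← Measure.map_map (hD n) hmeas]
    have : ∀ _ : Fin (n + 1), SigmaFinite (μ.map T) := fun _ => by rw [hμ]; infer_instance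
    rw [Measure.pi_map_pi fun _ => hT.aemeasurable, hμ]
  refine ⟨Measure.sum fun n => (2⁻¹ : ℝ≥0∞) ^ (n + 1) • κ n, ⟨?_⟩, ?_, fun U hU hU' => ?_⟩
  · rw [Measure.sum_apply _ MeasurableSet.univ]
    simp only [Measure.smul_apply, hκ, smul_eq_mul, mul_one]
    rw [ENNReal.tsum_geometric_add_one, ENNReal.one_sub_inv_two, inv_inv,
      ENNReal.inv_mul_cancel (by simp) (by simp)]
  · rw [Measure.map_sum (continuous_TM hT).aemeasurable]
    simp only [Measure.map_smul, hκT]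
  · obtain ⟨n, x, hx⟩ := exists_uniformAverage_mem hU hU'
    have : μ.IsOpenPosMeasure := ⟨fun V hV hV' => (hpos V hV hV').ne'⟩
    have hn : 0 < κ n U := by
      rw [Measure.map_apply (hD n) hU.measurableSet]
      exact (hU.preimage continuous_uniformAverage).measure_pos _ ⟨x, hx⟩
    refine lt_of_lt_of_le ?_ (Measure.le_sum (fun n => (2⁻¹ : ℝ≥0∞) ^ (n + 1) • κ n) n U)
    rw [Measure.smul_apply, smul_eq_mul]
    exact ENNReal.mul_pos (by simp) hn.ne'

theorem inter_preimage_nonempty_of_measure {T : X → X} (hT : Continuous T)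
    {θ : ProbabilityMeasure X} {U V : Set X} {n : ℕ} {a b : ℝ≥0∞} (hV : IsOpen V)
    (hab : 1 ≤ a + b) (hθU : a < (θ : Measure X) U)
    (hθV : b < ((TM T hT)^[n] θ : Measure X) V) : (U ∩ T^[n] ⁻¹' V).Nonempty := by
  rw [toMeasure_iterate_TM, Measure.map_apply (hT.iterate n).measurable hV.measurableSet] at hθV
  refine nonempty_inter_of_measure_lt_add (θ : Measure X)
    (hV.measurableSet.preimage (hT.iterate n).measurable) (subset_univ _) (subset_univ _) ?_
  rw [measure_univ]
  exact hab.trans_lt (ENNReal.add_lt_add hθU hθV)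

theorem isWeaklyMixing_of_isTransitive_TM {T : X → X} (hT : Continuous T) (hTs : Surjective T)
    (h : IsTransitive (TM T hT)) : IsWeaklyMixing T := by
  refine isWeaklyMixing_of_infinite_inter hT hTs ?_
  rintro U V₁ V₂ hU ⟨u, hu⟩ hV₁ ⟨v₁, hv₁⟩ hV₂ ⟨v₂, hv₂⟩
  have hlt : (3⁻¹ : ℝ≥0∞) < 2⁻¹ := by
    rw [ENNReal.inv_lt_inv]; norm_num
  have hsum : (1 : ℝ≥0∞) ≤ 2 * 3⁻¹ + 3⁻¹ := by
    rw [← add_one_mul]; norm_num [ENNReal.mul_inv_cancel]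
  have hhalf (v : Bool → X) (b : Bool) (V : Set X) (hV : IsOpen V) (hvV : v b ∈ V) :
      3⁻¹ < (uniformAverage v : Measure X) V := by
    refine hlt.trans_le ?_
    rw [toMeasure_uniformAverage, Measure.smul_apply, Measure.finsetSum_apply, Fintype.card_bool,
      smul_eq_mul]
    have h1 : 1 ≤ ∑ i, Measure.dirac (v i) V := by
      refine le_trans ?_ (Finset.single_le_sum (fun _ _ => zero_le) (Finset.mem_univ b))
      simp [Measure.dirac_apply_of_mem hvV]
    simpa using mul_le_mul_right h1 2⁻¹
  have hone : 2 * 3⁻¹ < (uniformAverage (fun _ : Unit => u) : Measure X) U := by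
    rw [toMeasure_uniformAverage]
    simp only [Fintype.card_unit, Nat.cast_one, inv_one, one_smul, Finset.univ_unique,
      Finset.sum_singleton, Measure.dirac_apply_of_mem hu]
    rw [← div_eq_mul_inv]
    exact ENNReal.div_lt_of_lt_mul (by norm_num)
  refine (h {θ | 2 * 3⁻¹ < (θ : Measure X) U}
    ({θ | 3⁻¹ < (θ : Measure X) V₁} ∩ {θ | 3⁻¹ < (θ : Measure X) V₂})
    (isOpen_setOf_lt_measure hU _) ⟨_, hone⟩
    ((isOpen_setOf_lt_measure hV₁ _).inter (isOpen_setOf_lt_measure hV₂ _))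
    ⟨uniformAverage fun b => cond b v₁ v₂, hhalf _ true V₁ hV₁ hv₁, hhalf _ false V₂ hV₂ hv₂⟩).mono ?_
  rintro n ⟨θ, hθU, hθ₁, hθ₂⟩
  exact ⟨inter_preimage_nonempty_of_measure hT hV₁ hsum hθU hθ₁,
    inter_preimage_nonempty_of_measure hT hV₂ hsum hθU hθ₂⟩

/-- The barycenter of a fully supported invariant measure is invariant and fully supported. -/
theorem exists_invariant_measure_of_TM
    {m : MeasurableSpace (ProbabilityMeasure X)} [BorelSpace (ProbabilityMeasure X)] {T : X → X}
    (hT : Continuous T) (ν : Measure (ProbabilityMeasure X)) [IsProbabilityMeasure ν]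
    (hν : ν.map (TM T hT) = ν)
    (hpos : ∀ U : Set (ProbabilityMeasure X), IsOpen U → U.Nonempty → 0 < ν U) :
    ∃ μ : Measure X, IsProbabilityMeasure μ ∧ μ.map T = μ ∧
      ∀ U : Set X, IsOpen U → U.Nonempty → 0 < μ U := by
  have hm : Measurable fun θ : ProbabilityMeasure X => (θ : Measure X) := measurable_toMeasure
  have hms {s : Set X} (hs : MeasurableSet s) :
      Measurable fun θ : ProbabilityMeasure X => (θ : Measure X) s :=
    (Measure.measurable_coe hs).comp hm
  have happ {s : Set X} (hs : MeasurableSet s) :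
      ν.bind (fun θ => (θ : Measure X)) s = ∫⁻ θ, (θ : Measure X) s ∂ν :=
    Measure.bind_apply hs hm.aemeasurable
  refine ⟨ν.bind fun θ => (θ : Measure X), ⟨?_⟩, ?_, fun U hU hU' => ?_⟩
  · simp [happ MeasurableSet.univ]
  · ext s hs
    rw [Measure.map_apply hT.measurable hs, happ (hT.measurable hs), happ hs]
    conv_rhs => rw [← hν]
    rw [lintegral_map (hms hs) (continuous_TM hT).measurable]
    refine lintegral_congr fun θ => ?_
    rw [toMeasure_TM, Measure.map_apply hT.measurable hs]
  · obtain ⟨u, hu⟩ := hU'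
    rw [happ hU.measurableSet, lintegral_pos_iff_support (hms hU.measurableSet)]
    refine (hpos _ (isOpen_setOf_lt_measure hU 0)
      ⟨uniformAverage fun _ : Unit => u, ?_⟩).trans_le (measure_mono fun θ hθ => hθ.ne')
    simp [toMeasure_uniformAverage, Measure.dirac_apply_of_mem hu]

end Measures

theorem wm_Esystem_iff_measures_Esystem {X : Type*}
    [MetricSpace X] [CompactSpace X] [MeasurableSpace X] [BorelSpace X]
    (T : X → X) (hT : Continuous T) (hTs : Surjective T) :
    (IsWeaklyMixing T ∧ IsESystem T) ↔ IsESystem (TM T hT) := by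
  let m : MeasurableSpace (ProbabilityMeasure X) := borel _
  have : @BorelSpace (ProbabilityMeasure X) _ m := @BorelSpace.mk _ _ m rfl
  rw [isESystem_iff T, @isESystem_iff _ _ m this (TM T hT)]
  constructor
  · rintro ⟨hw, -, μ, hμ, hinv, hpos⟩
    exact ⟨hw.isTransitive_TM hT, exists_invariant_measure_TM hT μ hinv hpos⟩
  · rintro ⟨ht, ν, hν, hinv, hpos⟩
    have hw := isWeaklyMixing_of_isTransitive_TM hT hTs ht
    exact ⟨hw, hw.isTransitive, exists_invariant_measure_of_TM hT ν hinv hpos⟩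

end Paper
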